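/- Let f : (k+1)^V → ℝ be a nonnegative monotone k-submodular function with f(0) = 0, let c be a cost function on V, and let B > 0 be a budget. Then every output s of the Greedy+Singleton algorithm with budget B (under arbitrary tie-breaking) satisfies c(s) ≤ B and 3·f(s) ≥ max{ f(x) : x ∈ (k+1)^V, c(x) ≤ B }. -/

import Mathlib

open Finset

section KSubmodularDefs

variable {V : Type*} [Fintype V] [DecidableEq V] {k : ℕ}

/-- The support of a `k`-tuple `x : V → Fin (k+1)` (value `0` means "not selected"). -/
def ksupp (x : V → Fin (k+1)) : Finset V := Finset.univ.filter fun e => x e ≠ 0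

/-- The meet `x ⊓ y`. -/
def kinf (x y : V → Fin (k+1)) : V → Fin (k+1) :=
  fun e => if x e = y e then x e else 0

/-- The join `x ⊔ y`. -/
def ksup (x y : V → Fin (k+1)) : V → Fin (k+1) :=
  fun e => if y e = 0 ∨ y e = x e then x e else if x e = 0 then y e else 0

/-- `f` is `k`-submodular. -/
def KSubmodular (f : (V → Fin (k+1)) → ℝ) : Prop :=
  ∀ x y : V → Fin (k+1), f (ksup x y) + f (kinf x y) ≤ f x + f y

/-- The partial order `x ⪯ y` on `(k+1)^V`. -/
def kle (x y : V → Fin (k+1)) : Prop := ∀ e : V, x e = 0 ∨ x e = y e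

/-- `f` is monotone with respect to `⪯`. -/
def KMonotone (f : (V → Fin (k+1)) → ℝ) : Prop :=
  ∀ x y : V → Fin (k+1), kle x y → f x ≤ f y

/-- The marginal gain `Δ_{e,j}(x)` of assigning element `e` to component `j`. -/
def margin (f : (V → Fin (k+1)) → ℝ) (x : V → Fin (k+1)) (e : V) (j : Fin (k+1)) : ℝ :=
  f (Function.update x e j) - f x

/-- The total cost `c(x)` of a tuple. -/
def kcost (c : V → ℝ) (x : V → Fin (k+1)) : ℝ := ∑ e ∈ ksupp x, c e

/-- One step of a greedy sequence relative to `o`: pick `e ∉ supp x` and `j ∈ {1,…,k}`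
maximizing the marginal gain over components (a), and with marginal density at least that of
every pair `(e', j')` with `e' ∈ supp o \ supp x` (b). -/
def GreedyStep (f : (V → Fin (k+1)) → ℝ) (c : V → ℝ) (o : V → Fin (k+1))
    (x x' : V → Fin (k+1)) : Prop :=
  ∃ e : V, ∃ j : Fin (k+1), x e = 0 ∧ j ≠ 0 ∧ x' = Function.update x e j ∧
    (∀ j' : Fin (k+1), j' ≠ 0 → margin f x e j' ≤ margin f x e j) ∧
    (∀ e' : V, o e' ≠ 0 → x e' = 0 → ∀ j' : Fin (k+1), j' ≠ 0 →
      margin f x e' j' * c e ≤ margin f x e j * c e')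

/-- `GreedyRun f c B s V0 out`: starting from partial solution `s` with remaining elements `V0`,
the greedy procedure with budget `B` (under some tie-breaking) can terminate with output `out`.
At each step a pair `(e, j)` of maximum marginal density among remaining elements is chosen;
`e` is added (placed in component `j`) iff it fits in the remaining budget, and is removed
from the remaining pool in either case. -/
inductive GreedyRun (f : (V → Fin (k+1)) → ℝ) (c : V → ℝ) (B : ℝ) :
    (V → Fin (k+1)) → Finset V → (V → Fin (k+1)) → Prop where
  | done (s : V → Fin (k+1)) : GreedyRun f c B s ∅ s
  | take (s : V → Fin (k+1)) (V0 : Finset V) (e : V) (j : Fin (k+1))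
      (out : V → Fin (k+1)) (he : e ∈ V0) (hj : j ≠ 0)
      (hbest : ∀ e' ∈ V0, ∀ j' : Fin (k+1), j' ≠ 0 →
        margin f s e' j' / c e' ≤ margin f s e j / c e)
      (hfit : kcost c s + c e ≤ B)
      (hrest : GreedyRun f c B (Function.update s e j) (V0.erase e) out) :
      GreedyRun f c B s V0 out
  | skip (s : V → Fin (k+1)) (V0 : Finset V) (e : V) (j : Fin (k+1))
      (out : V → Fin (k+1)) (he : e ∈ V0) (hj : j ≠ 0)
      (hbest : ∀ e' ∈ V0, ∀ j' : Fin (k+1), j' ≠ 0 →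
        margin f s e' j' / c e' ≤ margin f s e j / c e)
      (hnofit : ¬ kcost c s + c e ≤ B)
      (hrest : GreedyRun f c B s (V0.erase e) out) :
      GreedyRun f c B s V0 out

/-- The `k`-multilinear extension of `f`, as a function of `x : V → Fin (k+1) → ℝ`
(only the coordinates `x e j` with `j ≠ 0` are relevant). -/
noncomputable def kext (f : (V → Fin (k+1)) → ℝ) (x : V → Fin (k+1) → ℝ) : ℝ :=
  ∑ s : V → Fin (k+1), f s *
    ∏ e : V,
      (if s e = 0 then 1 - ∑ j ∈ Finset.univ.erase (0 : Fin (k+1)), x e j else x e (s e))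

/-- The partial derivative of `F` with respect to the coordinate `(e, j)` at the point `x`. -/
noncomputable def pderiv (F : (V → Fin (k+1) → ℝ) → ℝ) (e : V) (j : Fin (k+1))
    (x : V → Fin (k+1) → ℝ) : ℝ :=
  deriv (fun t : ℝ => F (Function.update x e (Function.update (x e) j t))) (x e j)

/-- Membership in the domain `Δ_k^V` of the multilinear extension. -/
def inSimplex (x : V → Fin (k+1) → ℝ) : Prop :=
  (∀ e : V, ∀ j : Fin (k+1), j ≠ 0 → 0 ≤ x e j ∧ x e j ≤ 1) ∧
  (∀ e : V, ∑ j ∈ Finset.univ.erase (0 : Fin (k+1)), x e j ≤ 1)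

end KSubmodularDefs

section GreedyAnalysis

variable {V : Type*} {k : ℕ}

lemma kle_zero (x : V → Fin (k+1)) : kle (fun _ => 0) x := fun _ => Or.inl rfl

lemma kle_trans {x y z : V → Fin (k+1)} (hxy : kle x y) (hyz : kle y z) : kle x z := by
  intro a
  rcases hxy a with h | h
  · exact Or.inl h
  · rw [h]; exact hyz a

/-- The tuple `s`, completed by `o` outside the support of `s`. -/
def overlay (o s : V → Fin (k+1)) : V → Fin (k+1) := fun a => if s a = 0 then o a else s a

lemma kle_overlay (o s : V → Fin (k+1)) : kle s (overlay o s) := by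
  intro a
  by_cases h : s a = 0 <;> simp [overlay, h]

variable [DecidableEq V]

lemma KSubmodular.margin_anti {f : (V → Fin (k+1)) → ℝ} (hsub : KSubmodular f)
    {x y : V → Fin (k+1)} (hxy : kle x y) {e : V} (hy : y e = 0) {j : Fin (k+1)} (hj : j ≠ 0) :
    margin f y e j ≤ margin f x e j := by
  have hx : x e = 0 := by rcases hxy e with h | h <;> simp [h, hy]
  have h := hsub (Function.update x e j) y
  have hsup : ksup (Function.update x e j) y = Function.update y e j := by
    funext a
    rcases eq_or_ne a e with rfl | ha
    · simp [ksup, hy]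
    · simp only [ksup, Function.update_of_ne ha]
      rcases hxy a with h | h <;> grind
  have hinf : kinf (Function.update x e j) y = x := by
    funext a
    rcases eq_or_ne a e with rfl | ha
    · simp [kinf, hy, hx, hj]
    · simp only [kinf, Function.update_of_ne ha]
      rcases hxy a with h | h <;> grind
  rw [hsup, hinf] at h
  unfold margin
  linarith

lemma kle_update {x : V → Fin (k+1)} {e : V} (he : x e = 0) (j : Fin (k+1)) :
    kle x (Function.update x e j) := by
  intro a
  rcases eq_or_ne a e with rfl | ha
  · exact Or.inl he
  · simp [Function.update_of_ne ha]

lemma overlay_update (o s : V → Fin (k+1)) (e : V) {j : Fin (k+1)} (hj : j ≠ 0) :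
    overlay o (Function.update s e j) = Function.update (overlay o s) e j := by
  funext a
  rcases eq_or_ne a e with rfl | ha
  · simp [overlay, hj]
  · simp [overlay, ha]

lemma KMonotone.margin_nonneg {f : (V → Fin (k+1)) → ℝ} (hmono : KMonotone f)
    {x : V → Fin (k+1)} {e : V} (he : x e = 0) (j : Fin (k+1)) : 0 ≤ margin f x e j :=
  sub_nonneg.2 (hmono _ _ (kle_update he j))

lemma f_overlay_le_update_of_zero {f : (V → Fin (k+1)) → ℝ} (hmono : KMonotone f)
    {o s : V → Fin (k+1)} {e : V} (he : s e = 0) (ho : o e = 0) {j : Fin (k+1)} (hj : j ≠ 0) :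
    f (overlay o s) ≤ f (overlay o (Function.update s e j)) := by
  rw [overlay_update o s e hj]
  exact hmono _ _ (kle_update (by simp [overlay, he, ho]) j)

lemma f_overlay_le_update_add_margin {f : (V → Fin (k+1)) → ℝ} (hsub : KSubmodular f)
    (hmono : KMonotone f) {o s : V → Fin (k+1)} {e : V} (he : s e = 0) (ho : o e ≠ 0)
    {j : Fin (k+1)} (hj : j ≠ 0) :
    f (overlay o s) ≤ f (overlay o (Function.update s e j)) + margin f s e (o e) := by
  rw [overlay_update o s e hj]
  set z := Function.update (overlay o s) e 0 with hz
  have hze : z e = 0 := by simp [hz]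
  have h1 : Function.update z e (o e) = overlay o s := by
    rw [hz, Function.update_idem]
    exact Function.update_eq_self_iff.2 (by simp [overlay, he])
  have h2 : Function.update z e j = Function.update (overlay o s) e j := by
    rw [hz, Function.update_idem]
  have hle : kle s z := by
    intro a
    rcases eq_or_ne a e with rfl | ha
    · exact Or.inl he
    · rw [hz, Function.update_of_ne ha]; exact kle_overlay o s a
  have h3 := hsub.margin_anti hle hze ho
  have h4 := hmono _ _ (kle_update hze j)
  rw [h2] at h4
  rw [margin, h1] at h3
  linarith

variable [Fintype V]

lemma kcost_update (c : V → ℝ) {x : V → Fin (k+1)} {e : V} (he : x e = 0) {j : Fin (k+1)}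
    (hj : j ≠ 0) : kcost c (Function.update x e j) = kcost c x + c e := by
  have h : ksupp (Function.update x e j) = insert e (ksupp x) := by
    ext a
    rcases eq_or_ne a e with rfl | ha
    · simp [ksupp, hj]
    · simp [ksupp, ha]
  rw [kcost, h, Finset.sum_insert (by simp [ksupp, he]), add_comm]
  rfl

lemma f_overlay_le_add_sum_margin {f : (V → Fin (k+1)) → ℝ} (hsub : KSubmodular f)
    (o s : V → Fin (k+1)) :
    f (overlay o s) ≤ f s + ∑ e with s e = 0 ∧ o e ≠ 0, margin f s e (o e) := by
  have key : ∀ T : Finset V, (∀ e ∈ T, s e = 0 ∧ o e ≠ 0) →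
      f (fun a => if a ∈ T then o a else s a) ≤ f s + ∑ e ∈ T, margin f s e (o e) := by
    intro T
    induction T using Finset.induction_on with
    | empty => intro _; simp
    | insert e T heT ih =>
      intro hT
      have hrest := ih fun a ha => hT a (Finset.mem_insert_of_mem ha)
      obtain ⟨hse, hoe⟩ := hT e (Finset.mem_insert_self _ _)
      have hle : kle s (fun a => if a ∈ T then o a else s a) := by
        intro a
        by_cases ha : a ∈ T
        · exact Or.inl (hT a (Finset.mem_insert_of_mem ha)).1
        · simp [ha]
      have h := hsub.margin_anti hle (e := e) (by simp [heT, hse]) hoe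
      have hup : Function.update (fun a => if a ∈ T then o a else s a) e (o e)
          = fun a => if a ∈ insert e T then o a else s a := by
        funext a
        rcases eq_or_ne a e with rfl | ha
        · simp
        · simp [ha]
      rw [margin, hup] at h
      rw [Finset.sum_insert heT]
      linarith
  have h := key (Finset.univ.filter fun e => s e = 0 ∧ o e ≠ 0) (by simp)
  convert h using 2
  funext a
  by_cases hs : s a = 0 <;> by_cases ho : o a = 0 <;> simp [overlay, hs, ho]

lemma GreedyRun.kle_output {f : (V → Fin (k+1)) → ℝ} {c : V → ℝ} {B : ℝ} {s g : V → Fin (k+1)}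
    {V0 : Finset V} (h : GreedyRun f c B s V0 g) (hV0 : ∀ e ∈ V0, s e = 0) : kle s g := by
  induction h with
  | done s => exact fun _ => Or.inr rfl
  | take s V0 e j out he hj hbest hfit hrest ih =>
    refine kle_trans (kle_update (hV0 e he) j) (ih fun a ha => ?_)
    rw [Function.update_of_ne (Finset.ne_of_mem_erase ha)]
    exact hV0 a (Finset.mem_of_mem_erase ha)
  | skip s V0 e j out he hj hbest hnofit hrest ih =>
    exact ih fun a ha => hV0 a (Finset.mem_of_mem_erase ha)

lemma GreedyRun.kcost_le {f : (V → Fin (k+1)) → ℝ} {c : V → ℝ} {B : ℝ} {s g : V → Fin (k+1)}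
    {V0 : Finset V} (h : GreedyRun f c B s V0 g) (hV0 : ∀ e ∈ V0, s e = 0)
    (hs : kcost c s ≤ B) : kcost c g ≤ B := by
  induction h with
  | done s => exact hs
  | take s V0 e j out he hj hbest hfit hrest ih =>
    refine ih (fun a ha => ?_) ((kcost_update c (hV0 e he) hj).trans_le hfit)
    rw [Function.update_of_ne (Finset.ne_of_mem_erase ha)]
    exact hV0 a (Finset.mem_of_mem_erase ha)
  | skip s V0 e j out he hj hbest hnofit hrest ih =>
    exact ih (fun a ha => hV0 a (Finset.mem_of_mem_erase ha)) hs

/-- If an element of `supp o` of maximum marginal density does not fit, then the marginal gains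
of the elements of `supp o \ supp s` are paid for by that element and the elements of
`supp s \ supp o`. -/
lemma sum_margin_le_of_not_fit {f : (V → Fin (k+1)) → ℝ} (hmono : KMonotone f) {c : V → ℝ}
    (hc : ∀ e, 0 < c e) {B : ℝ} {o s : V → Fin (k+1)} (ho : kcost c o ≤ B) {e : V}
    {j : Fin (k+1)} (hse : s e = 0)
    (hbest : ∀ a, s a = 0 → o a ≠ 0 → margin f s a (o a) / c a ≤ margin f s e j / c e)
    (hnofit : ¬ kcost c s + c e ≤ B) {b : ℝ}
    (hb : margin f s e j * ∑ a with s a ≠ 0 ∧ o a = 0, c a ≤ c e * b) :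
    ∑ a with s a = 0 ∧ o a ≠ 0, margin f s a (o a) ≤ margin f s e j + b := by
  set δ := margin f s e j / c e with hδ
  have hδ0 : 0 ≤ δ := div_nonneg (hmono.margin_nonneg hse j) (hc e).le
  have hδe : δ * c e = margin f s e j := div_mul_cancel₀ _ (hc e).ne'
  have h1 : ∑ a with s a = 0 ∧ o a ≠ 0, margin f s a (o a)
      ≤ δ * ∑ a with s a = 0 ∧ o a ≠ 0, c a := by
    rw [Finset.mul_sum]
    refine Finset.sum_le_sum fun a ha => ?_
    simp only [Finset.mem_filter, Finset.mem_univ, true_and] at ha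
    exact (div_le_iff₀ (hc a)).1 (hbest a ha.1 ha.2)
  have h2 : kcost c o + ∑ a with s a ≠ 0 ∧ o a = 0, c a
      = kcost c s + ∑ a with s a = 0 ∧ o a ≠ 0, c a := by
    simp only [kcost, ksupp, Finset.sum_filter, ← Finset.sum_add_distrib]
    refine Finset.sum_congr rfl fun a _ => ?_
    by_cases hs : s a = 0 <;> by_cases ho : o a = 0 <;> simp [hs, ho]
  have h3 : ∑ a with s a = 0 ∧ o a ≠ 0, c a ≤ c e + ∑ a with s a ≠ 0 ∧ o a = 0, c a := by
    linarith
  have h4 := mul_le_mul_of_nonneg_left h3 hδ0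
  have h5 : δ * ∑ a with s a ≠ 0 ∧ o a = 0, c a ≤ b := by
    refine le_of_mul_le_mul_left ?_ (hc e)
    rw [← mul_assoc, mul_comm (c e) δ, hδe]
    exact hb
  linarith

/-- Along a greedy run, `a` bounds the part of `f s` gained on `supp o`, while the remaining part
`f s - a` is gained outside `supp o`, at a density no smaller than any available one. -/
lemma GreedyRun.f_le_three_mul {f : (V → Fin (k+1)) → ℝ} (hsub : KSubmodular f)
    (hmono : KMonotone f) (hnonneg : ∀ x, 0 ≤ f x) (hzero : f (fun _ => 0) = 0) {c : V → ℝ}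
    (hc : ∀ e, 0 < c e) {B M : ℝ} {o : V → Fin (k+1)} (ho : kcost c o ≤ B)
    (hsing : ∀ y : V → Fin (k+1), (ksupp y).card = 1 → kcost c y ≤ B → f y ≤ M)
    {s g : V → Fin (k+1)} {V0 : Finset V} (h : GreedyRun f c B s V0 g) (hg : f g ≤ M)
    (hV0 : ∀ e ∈ V0, s e = 0) (hoV0 : ∀ e, s e = 0 → o e ≠ 0 → e ∈ V0) {a : ℝ} (ha : a ≤ f s)
    (hfo : f o ≤ f (overlay o s) + a)
    (hdens : ∀ e ∈ V0, ∀ j : Fin (k+1), j ≠ 0 →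
      margin f s e j * ∑ i with s i ≠ 0 ∧ o i = 0, c i ≤ c e * (f s - a)) :
    f o ≤ 3 * M := by
  induction h generalizing a with
  | done s =>
    have hov : overlay o s = s := by
      funext i
      by_cases hs : s i = 0
      · have : o i = 0 := by
          by_contra hoi
          exact Finset.notMem_empty _ (hoV0 i hs hoi)
        simp [overlay, hs, this]
      · simp [overlay, hs]
    rw [hov] at hfo
    linarith [hnonneg s]
  | take s V0 e j out he hj hbest hfit hrest ih =>
    have hse := hV0 e he
    have hm : f (Function.update s e j) = f s + margin f s e j := by unfold margin; ring
    have hm0 := hmono.margin_nonneg hse j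
    have hV0' : ∀ i ∈ V0.erase e, Function.update s e j i = 0 := fun i hi => by
      rw [Function.update_of_ne (Finset.ne_of_mem_erase hi)]
      exact hV0 i (Finset.mem_of_mem_erase hi)
    have hoV0' : ∀ i, Function.update s e j i = 0 → o i ≠ 0 → i ∈ V0.erase e := by
      intro i hi hoi
      have hie : i ≠ e := by rintro rfl; simp [hj] at hi
      rw [Function.update_of_ne hie] at hi
      exact Finset.mem_erase.2 ⟨hie, hoV0 i hi hoi⟩
    have hanti : ∀ i ∈ V0.erase e, ∀ l : Fin (k+1), l ≠ 0 →
        margin f (Function.update s e j) i l ≤ margin f s i l := fun i hi l hl =>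
      hsub.margin_anti (kle_update hse j) (hV0' i hi) hl
    by_cases hoe : o e = 0
    · have hsum : ∑ i with Function.update s e j i ≠ 0 ∧ o i = 0, c i
          = c e + ∑ i with s i ≠ 0 ∧ o i = 0, c i := by
        rw [← Finset.sum_insert (by simp [hse])]
        refine Finset.sum_congr ?_ fun _ _ => rfl
        ext i
        rcases eq_or_ne i e with rfl | hi
        · simp [hj, hoe]
        · simp [hi]
      refine ih hg hV0' hoV0' (a := a) (by linarith)
        (hfo.trans (by linarith [f_overlay_le_update_of_zero hmono hse hoe hj])) ?_
      intro i hi l hl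
      have hiV := Finset.mem_of_mem_erase hi
      have hold := hdens i hiV l hl
      have hb := hbest i hiV l hl
      rw [div_le_div_iff₀ (hc i) (hc e)] at hb
      have hpos : 0 ≤ c e + ∑ i with s i ≠ 0 ∧ o i = 0, c i :=
        add_nonneg (hc e).le (Finset.sum_nonneg fun i _ => (hc i).le)
      rw [hsum, hm]
      have := mul_le_mul_of_nonneg_right (hanti i hi l hl) hpos
      linarith
    · have hsum : ∑ i with Function.update s e j i ≠ 0 ∧ o i = 0, c i
          = ∑ i with s i ≠ 0 ∧ o i = 0, c i := by
        refine Finset.sum_congr ?_ fun _ _ => rfl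
        ext i
        rcases eq_or_ne i e with rfl | hi
        · simp [hoe]
        · simp [hi]
      have hb : margin f s e (o e) ≤ margin f s e j :=
        (div_le_div_iff_of_pos_right (hc e)).1 (hbest e he (o e) hoe)
      refine ih hg hV0' hoV0' (a := a + margin f s e j) (by linarith)
        (hfo.trans (by linarith [f_overlay_le_update_add_margin hsub hmono hse hoe hj])) ?_
      intro i hi l hl
      have hold := hdens i (Finset.mem_of_mem_erase hi) l hl
      have hpos : 0 ≤ ∑ i with s i ≠ 0 ∧ o i = 0, c i :=
        Finset.sum_nonneg fun i _ => (hc i).le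
      rw [hsum, hm]
      have := mul_le_mul_of_nonneg_right (hanti i hi l hl) hpos
      linarith
  | skip s V0 e j out he hj hbest hnofit hrest ih =>
    have hV0' : ∀ i ∈ V0.erase e, s i = 0 := fun i hi => hV0 i (Finset.mem_of_mem_erase hi)
    by_cases hoe : o e = 0
    · refine ih hg hV0' (fun i hi hoi => Finset.mem_erase.2 ⟨?_, hoV0 i hi hoi⟩) ha hfo
        fun i hi => hdens i (Finset.mem_of_mem_erase hi)
      rintro rfl
      exact hoi hoe
    · have hse := hV0 e he
      have hsum := sum_margin_le_of_not_fit hmono hc ho hse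
        (fun i hi hoi => hbest i (hoV0 i hi hoi) (o i) hoi) hnofit (hdens e he j hj)
      have hov := f_overlay_le_add_sum_margin hsub o s
      have hsg := hmono _ _ (hrest.kle_output hV0')
      have hanti := hsub.margin_anti (kle_zero s) hse hj
      have hcost : kcost c (Function.update (fun _ => (0 : Fin (k+1))) e j) ≤ B := by
        rw [kcost_update c rfl hj]
        have h1 : c e ≤ kcost c o :=
          Finset.single_le_sum (f := c) (fun i _ => (hc i).le) (by simp [ksupp, hoe])
        have h2 : kcost c (fun _ => (0 : Fin (k+1))) = 0 := by simp [kcost, ksupp]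
        linarith
      have hcard : (ksupp (Function.update (fun _ => (0 : Fin (k+1))) e j)).card = 1 := by
        refine Finset.card_eq_one.2 ⟨e, ?_⟩
        ext i
        rcases eq_or_ne i e with rfl | hi
        · simp [ksupp, hj]
        · simp [ksupp, hi]
      have hy := hsing _ hcard hcost
      have h0 : margin f (fun _ => 0) e j = f (Function.update (fun _ => 0) e j) := by
        simp [margin, hzero]
      linarith

end GreedyAnalysis

/-- Greedy+Singleton is a `1/3`-approximation for monotone `k`-submodular
maximization under a knapsack constraint: the output `s` — the better (w.r.t. `f`) of a greedy
run `g` started from `0` and a best feasible singleton (if one exists) — is feasible and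
satisfies `3·f(s) ≥ f(x)` for every feasible `x`. -/
theorem greedy_plus_singleton_monotone_third
    {V : Type*} [Fintype V] [DecidableEq V] {k : ℕ} (hk : 1 ≤ k)
    (f : (V → Fin (k+1)) → ℝ)
    (hsub : KSubmodular f) (hmono : KMonotone f)
    (hnonneg : ∀ x : V → Fin (k+1), 0 ≤ f x) (hzero : f (fun _ => 0) = 0)
    (c : V → ℝ) (hc : ∀ e : V, 0 < c e) (B : ℝ) (hB : 0 < B)
    (g : V → Fin (k+1)) (hg : GreedyRun f c B (fun _ => 0) Finset.univ g)
    (s : V → Fin (k+1))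
    (hform : s = g ∨ ((ksupp s).card = 1 ∧ kcost c s ≤ B))
    (hsg : f g ≤ f s)
    (hsy : ∀ y : V → Fin (k+1), (ksupp y).card = 1 → kcost c y ≤ B → f y ≤ f s) :
    kcost c s ≤ B ∧ ∀ x : V → Fin (k+1), kcost c x ≤ B → f x ≤ 3 * f s := by
  constructor
  · rcases hform with rfl | ⟨-, h⟩
    · exact hg.kcost_le (by simp) (by simpa [kcost, ksupp] using hB.le)
    · exact h
  · intro x hx
    have hov : overlay x (fun _ => 0) = x := by funext i; simp [overlay]
    refine hg.f_le_three_mul hsub hmono hnonneg hzero hc hx hsy hsg (by simp) (by simp)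
      (a := 0) hzero.ge (by simp [hov]) ?_
    simp [hzero]
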